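/- Let f : (M,∂M) → (N,∂N) be a map of pairs between compact, connected, oriented n-manifolds with boundary. Then ‖M‖_I ≥ |deg(f)| · ‖N‖_I, where ‖·‖_I denotes the ideal simplicial volume. -/

import Mathlib

open scoped BigOperators
open Topology
noncomputable section

/-! ### Quasicones and marked spaces -/

/-- `B` is a *quasicone* with apex `b`: there is a homotopy `H` from the identity to the
constant map at `b` with `H ⁻¹' {b} = ({b} × I) ∪ (B × {1})`. -/
def IsQuasicone {B : Type*} [TopologicalSpace B] (b : B) : Prop :=
  ∃ H : C(B × unitInterval, B),
    (∀ x, H (x, 0) = x) ∧ (∀ x, H (x, 1) = b) ∧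
    (∀ x t, H (x, t) = b ↔ x = b ∨ t = 1)

/-- A *marked space* `(X, B)`: `B` is closed in `X` and every `b ∈ B` has a closed
quasiconical neighbourhood `F b` with apex `b`, the `F b` being pairwise disjoint. -/
structure IsMarkedSpace (X : Type*) [TopologicalSpace X] (B : Set X) : Prop where
  closed : IsClosed B
  quasicones : ∃ F : B → Set X,
    (∀ b : B, IsClosed (F b)) ∧ (∀ b : B, F b ∈ nhds (b : X)) ∧
    (∀ b b' : B, b ≠ b' → Disjoint (F b) (F b')) ∧
    (∀ b : B, ∃ hb : (b : X) ∈ F b, IsQuasicone (⟨(b : X), hb⟩ : F b))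

/-! ### Singular chains -/

/-- The topological standard `n`-simplex. -/
abbrev TopSimplex (n : ℕ) : Type := ↥(stdSimplex ℝ (Fin (n + 1)))

/-- Singular `n`-simplices in `X`. -/
abbrev SingularSimplex (X : Type*) [TopologicalSpace X] (n : ℕ) := C(TopSimplex n, X)

/-- Singular `n`-chains in `X` with coefficients in `R`. -/
abbrev SingularChain (R : Type*) [Ring R] (X : Type*) [TopologicalSpace X] (n : ℕ) :=
  SingularSimplex X n →₀ R

/-- The `i`-th coface map, on barycentric coordinates. -/
def cofaceFun {n : ℕ} (i : Fin (n + 2)) (x : Fin (n + 1) → ℝ) : Fin (n + 2) → ℝ :=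
  fun j => ∑ k : Fin (n + 1), if i.succAbove k = j then x k else 0

lemma cofaceFun_mem {n : ℕ} (i : Fin (n + 2)) {x : Fin (n + 1) → ℝ}
    (hx : x ∈ stdSimplex ℝ (Fin (n + 1))) : cofaceFun i x ∈ stdSimplex ℝ (Fin (n + 2)) := by
  constructor
  · intro j
    refine Finset.sum_nonneg fun k _ => ?_
    split_ifs
    · exact hx.1 k
    · exact le_rfl
  · unfold cofaceFun
    rw [Finset.sum_comm]
    simp only [Finset.sum_ite_eq, Finset.mem_univ, if_true]
    exact hx.2

/-- The `i`-th face inclusion `Δⁿ → Δⁿ⁺¹`. -/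
def coface {n : ℕ} (i : Fin (n + 2)) : C(TopSimplex n, TopSimplex (n + 1)) where
  toFun x := ⟨cofaceFun i (x : Fin (n + 1) → ℝ), cofaceFun_mem i x.2⟩
  continuous_toFun := by
    refine Continuous.subtype_mk ?_ _
    refine continuous_pi fun j => ?_
    unfold cofaceFun
    refine continuous_finset_sum _ fun k _ => ?_
    by_cases h : i.succAbove k = j
    · simp only [if_pos h]
      exact (continuous_apply k).comp continuous_subtype_val
    · simp only [if_neg h]
      exact continuous_const

/-- The boundary of a single `(n+1)`-simplex. -/
def boundaryOf (R : Type*) [Ring R] {X : Type*} [TopologicalSpace X] {n : ℕ}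
    (σ : SingularSimplex X (n + 1)) : SingularChain R X n :=
  ∑ i : Fin (n + 2), Finsupp.single (σ.comp (coface i)) ((-1 : R) ^ (i : ℕ))

/-- The singular boundary operator. -/
def boundary (R : Type*) [Ring R] (X : Type*) [TopologicalSpace X] (n : ℕ) :
    SingularChain R X (n + 1) →ₗ[R] SingularChain R X n :=
  Finsupp.lsum ℕ fun σ => LinearMap.toSpanSingleton R _ (boundaryOf R σ)

/-- Push-forward of chains along a continuous map. -/
def pushChain (R : Type*) [Ring R] {X Y : Type*} [TopologicalSpace X] [TopologicalSpace Y]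
    (f : C(X, Y)) (n : ℕ) : SingularChain R X n →ₗ[R] SingularChain R Y n :=
  Finsupp.lmapDomain R R fun σ : SingularSimplex X n => f.comp σ

/-- The face of `Δⁿ` spanned by the vertices in `S`. -/
def faceSet (n : ℕ) (S : Finset (Fin (n + 1))) : Set (TopSimplex n) :=
  {x | ∀ j ∉ S, (x : Fin (n + 1) → ℝ) j = 0}

/-- A subset of `Δⁿ` which is a union of (not necessarily proper) faces. -/
def IsSimplicialSubcomplex {n : ℕ} (A : Set (TopSimplex n)) : Prop :=
  ∃ 𝒮 : Set (Finset (Fin (n + 1))), A = ⋃ S ∈ 𝒮, faceSet n S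

/-- A singular simplex is *admissible* if the preimage of `B` is a union of faces. -/
def Admissible {X : Type*} [TopologicalSpace X] (B : Set X) {n : ℕ}
    (σ : SingularSimplex X n) : Prop :=
  IsSimplicialSubcomplex (σ ⁻¹' B)

/-- The submodule generated by admissible simplices. -/
def admissibleChains (R : Type*) [Ring R] (X : Type*) [TopologicalSpace X] (B : Set X)
    (n : ℕ) : Submodule R (SingularChain R X n) :=
  Submodule.span R {c | ∃ σ : SingularSimplex X n, Admissible B σ ∧ c = Finsupp.single σ 1}

/-- The submodule generated by simplices supported in `B`. -/
def chainsIn (R : Type*) [Ring R] (X : Type*) [TopologicalSpace X] (B : Set X)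
    (n : ℕ) : Submodule R (SingularChain R X n) :=
  Submodule.span R {c | ∃ σ : SingularSimplex X n, Set.range ⇑σ ⊆ B ∧ c = Finsupp.single σ 1}

/-- Cycles of the marked chain complex `C^M_*(X,B;R) = Ĉ^M_*(X,B;R)/C_*(B;R)`:
admissible chains whose boundary is supported in `B`. -/
def markedCycles (R : Type*) [Ring R] (X : Type*) [TopologicalSpace X] (B : Set X) :
    (n : ℕ) → Submodule R (SingularChain R X n)
  | 0 => admissibleChains R X B 0
  | (n + 1) => admissibleChains R X B (n + 1) ⊓
      Submodule.comap (boundary R X n) (chainsIn R X B n)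

/-- Boundaries of the marked chain complex. -/
def markedBoundaries (R : Type*) [Ring R] (X : Type*) [TopologicalSpace X] (B : Set X)
    (n : ℕ) : Submodule R (SingularChain R X n) :=
  Submodule.map (boundary R X n) (admissibleChains R X B (n + 1)) ⊔ chainsIn R X B n

/-- Relative cycles of the pair `(X, B)`. -/
def relativeCycles (R : Type*) [Ring R] (X : Type*) [TopologicalSpace X] (B : Set X) :
    (n : ℕ) → Submodule R (SingularChain R X n)
  | 0 => ⊤
  | (n + 1) => Submodule.comap (boundary R X n) (chainsIn R X B n)

/-- Relative boundaries of the pair `(X, B)`. -/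
def relativeBoundaries (R : Type*) [Ring R] (X : Type*) [TopologicalSpace X] (B : Set X)
    (n : ℕ) : Submodule R (SingularChain R X n) :=
  Submodule.map (boundary R X n) ⊤ ⊔ chainsIn R X B n

/-- The ℓ¹-norm of a real singular chain. -/
def l1Norm {X : Type*} [TopologicalSpace X] {n : ℕ} (c : SingularChain ℝ X n) : ℝ :=
  c.sum fun _ r => |r|

/-! ### The marked space associated to a manifold with boundary, and simplicial volumes -/

/-- The relation collapsing each connected component of `bd` to a point. -/
def collapseRel (X : Type*) (bd : Set X) [TopologicalSpace X] : X → X → Prop := fun a b =>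
  a = b ∨ (a ∈ bd ∧ b ∈ bd ∧ connectedComponentIn bd a = connectedComponentIn bd b)

/-- The quotient of `X` obtained by collapsing each connected component of `bd`
to a point. -/
abbrev Collapse (X : Type*) [TopologicalSpace X] (bd : Set X) : Type _ :=
  Quot (collapseRel X bd)

/-- The natural projection onto the collapsed space. -/
def collapseMap (X : Type*) [TopologicalSpace X] (bd : Set X) : C(X, Collapse X bd) :=
  ⟨Quot.mk _, continuous_quot_mk⟩

/-- The marked points: the images of the components of `bd`. -/
def collapsedBoundary (X : Type*) [TopologicalSpace X] (bd : Set X) : Set (Collapse X bd) :=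
  (collapseMap X bd) '' bd

/-- `ζ` is a relative fundamental cycle: it is a relative cycle which is not a relative
boundary, and whose class generates `H_n(X, bd; ℝ)`. -/
def IsFundamentalClassData (X : Type*) [TopologicalSpace X] (bd : Set X) (n : ℕ)
    (ζ : SingularChain ℝ X n) : Prop :=
  ζ ∈ relativeCycles ℝ X bd n ∧ ζ ∉ relativeBoundaries ℝ X bd n ∧
    ∀ z ∈ relativeCycles ℝ X bd n, ∃ r : ℝ, z - r • ζ ∈ relativeBoundaries ℝ X bd n

/-- `bd` admits a closed collar inside `X`. -/
def HasBoundaryCollar (X : Type*) [TopologicalSpace X] (bd : Set X) : Prop :=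
  ∃ φ : C((↥bd) × unitInterval, X), IsClosedEmbedding φ ∧ (∀ x : bd, φ (x, 0) = (x : X)) ∧
    Set.range φ ∈ nhdsSet bd ∧ ∀ (x : bd) (t : unitInterval), φ (x, t) ∈ bd ↔ t = 0

/-- Encoding of "`X` is a compact connected oriented topological `n`-manifold with
boundary `bd` and (real) relative fundamental cycle `ζ`". -/
structure IsCptMfdBdry (X : Type*) [TopologicalSpace X] (bd : Set X) (n : ℕ)
    (ζ : SingularChain ℝ X n) : Prop where
  compact : CompactSpace X
  connected : ConnectedSpace X
  bd_closed : IsClosed bd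
  collar : HasBoundaryCollar X bd
  fund : IsFundamentalClassData X bd n ζ

/-- Gromov's simplicial volume `‖M‖`: the infimum of the ℓ¹-norms of the relative cycles
representing the (class of the) relative fundamental cycle `ζ`. -/
def simplicialVolume (X : Type*) [TopologicalSpace X] (bd : Set X) (n : ℕ)
    (ζ : SingularChain ℝ X n) : ℝ :=
  sInf { r | ∃ z, z ∈ relativeCycles ℝ X bd n ∧
    z - ζ ∈ relativeBoundaries ℝ X bd n ∧ r = l1Norm z }

/-- The push-forward of the fundamental cycle to the marked space associated to `(X, bd)`. -/
def idealFundamentalRep (X : Type*) [TopologicalSpace X] (bd : Set X) (n : ℕ)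
    (ζ : SingularChain ℝ X n) : SingularChain ℝ (Collapse X bd) n :=
  pushChain ℝ (collapseMap X bd) n ζ

/-- `z` is a marked cycle representing the ideal fundamental class `[M, ∂M]^M`. -/
def IdealRepresents (X : Type*) [TopologicalSpace X] (bd : Set X) (n : ℕ)
    (ζ : SingularChain ℝ X n) (z : SingularChain ℝ (Collapse X bd) n) : Prop :=
  z ∈ markedCycles ℝ (Collapse X bd) (collapsedBoundary X bd) n ∧
    z - idealFundamentalRep X bd n ζ ∈
      relativeBoundaries ℝ (Collapse X bd) (collapsedBoundary X bd) n

/-- The ideal simplicial volume `‖M‖_I`: the infimum of the ℓ¹-norms of the marked cycles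
representing the ideal fundamental class. -/
def idealSimplicialVolume (X : Type*) [TopologicalSpace X] (bd : Set X) (n : ℕ)
    (ζ : SingularChain ℝ X n) : ℝ :=
  sInf { r | ∃ z, IdealRepresents X bd n ζ z ∧ r = l1Norm z }

/-! ### Alternating double sums -/

/-- The combinatorial identity behind the prism operator: the alternating double sum of the
faces `β i j` of the prism simplices is the top minus the bottom minus the alternating double
sum of the prism simplices `α i j` on the faces. -/
lemma sum_prism_faces {M : Type*} [AddCommGroup M] [Module ℝ M] {n : ℕ}
    (β : Fin (n + 3) → Fin (n + 2) → M) (α : Fin (n + 2) → Fin (n + 1) → M)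
    (hlow : ∀ i j, i ≤ j.castSucc → β i.castSucc j.succ = α i j)
    (hdiag : ∀ j : Fin (n + 1), β j.castSucc.succ j.succ = β j.castSucc.succ j.castSucc)
    (hhigh : ∀ i j, j.castSucc < i → β i.succ j.castSucc = α i j) :
    ∑ j : Fin (n + 2), ∑ i : Fin (n + 3), ((-1 : ℝ) ^ (j : ℕ) * (-1) ^ (i : ℕ)) • β i j =
      β 0 0 - β (Fin.last _) (Fin.last _) -
        ∑ i : Fin (n + 2), ∑ j : Fin (n + 1),
          ((-1 : ℝ) ^ (i : ℕ) * (-1) ^ (j : ℕ)) • α i j := by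
  classical
  have split : ∀ j : Fin (n + 2), ∑ i : Fin (n + 3),
      ((-1 : ℝ) ^ (j : ℕ) * (-1) ^ (i : ℕ)) • β i j =
      (β j.castSucc j - β j.succ j) +
        ((∑ i : Fin (n + 3), if i < j.castSucc then
            ((-1 : ℝ) ^ (j : ℕ) * (-1) ^ (i : ℕ)) • β i j else 0) +
          ∑ i : Fin (n + 3), if j.succ < i then
            ((-1 : ℝ) ^ (j : ℕ) * (-1) ^ (i : ℕ)) • β i j else 0) := by
    intro j
    have e : β j.castSucc j - β j.succ j = ∑ i : Fin (n + 3),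
        ((if i = j.castSucc then ((-1 : ℝ) ^ (j : ℕ) * (-1) ^ (i : ℕ)) • β i j else 0) +
         (if i = j.succ then ((-1 : ℝ) ^ (j : ℕ) * (-1) ^ (i : ℕ)) • β i j else 0)) := by
      rw [Finset.sum_add_distrib]
      simp [pow_succ, ← mul_pow, sub_eq_add_neg]
    rw [e, ← Finset.sum_add_distrib, ← Finset.sum_add_distrib]
    refine Finset.sum_congr rfl fun i _ => ?_
    rcases lt_trichotomy i j.castSucc with h | h | h
    · have h1 : i ≠ j.castSucc := h.ne
      have h2 : i ≠ j.succ := by grind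
      have h3 : ¬ j.succ < i := by grind
      simp [h, h1, h2, h3]
    · subst h
      have h2 : j.castSucc ≠ j.succ := by grind
      have h3 : ¬ j.succ < j.castSucc := by grind
      simp [h2, h3]
    · have h1 : i ≠ j.castSucc := h.ne'
      have h4 : ¬ i < j.castSucc := by grind
      by_cases h2 : i = j.succ
      · subst h2
        simp [h1, h4]
      · have h3 : j.succ < i := by grind
        simp [h1, h2, h3, h4]
  have diag : ∑ j : Fin (n + 2), (β j.castSucc j - β j.succ j) =
      β 0 0 - β (Fin.last _) (Fin.last _) := by
    rw [Finset.sum_sub_distrib, Fin.sum_univ_succ, Fin.sum_univ_castSucc (fun j => β j.succ j)]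
    have : ∑ i : Fin (n + 1), β i.succ.castSucc i.succ =
        ∑ i : Fin (n + 1), β i.castSucc.succ i.castSucc :=
      Finset.sum_congr rfl fun i _ => by rw [← hdiag]; rfl
    rw [this, add_comm (∑ i : Fin (n + 1), _), add_sub_add_right_eq_sub]
    rfl
  have low : (∑ j : Fin (n + 2), ∑ i : Fin (n + 3), if i < j.castSucc then
      ((-1 : ℝ) ^ (j : ℕ) * (-1) ^ (i : ℕ)) • β i j else 0) =
      -∑ i : Fin (n + 2), ∑ j : Fin (n + 1), if i ≤ j.castSucc then
        ((-1 : ℝ) ^ (i : ℕ) * (-1) ^ (j : ℕ)) • α i j else 0 := by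
    rw [Fin.sum_univ_succ, Finset.sum_comm (s := (Finset.univ : Finset (Fin (n + 2)))),
      ← Finset.sum_neg_distrib]
    have z : ∀ i : Fin (n + 3), ¬ i < (0 : Fin (n + 2)).castSucc := by simp
    simp only [z, if_false, Finset.sum_const_zero, zero_add]
    refine Finset.sum_congr rfl fun j _ => ?_
    rw [Fin.sum_univ_castSucc, if_neg (by grind), add_zero, ← Finset.sum_neg_distrib]
    refine Finset.sum_congr rfl fun i _ => ?_
    by_cases h : i ≤ j.castSucc
    · rw [if_pos h, if_pos (by grind), hlow i j h, ← neg_smul]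
      congr 1
      simp only [Fin.val_succ, Fin.val_castSucc]
      ring
    · rw [if_neg h, if_neg (by grind), neg_zero]
  have high : (∑ j : Fin (n + 2), ∑ i : Fin (n + 3), if j.succ < i then
      ((-1 : ℝ) ^ (j : ℕ) * (-1) ^ (i : ℕ)) • β i j else 0) =
      -∑ i : Fin (n + 2), ∑ j : Fin (n + 1), if j.castSucc < i then
        ((-1 : ℝ) ^ (i : ℕ) * (-1) ^ (j : ℕ)) • α i j else 0 := by
    rw [Fin.sum_univ_castSucc, Finset.sum_comm (s := (Finset.univ : Finset (Fin (n + 2)))),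
      ← Finset.sum_neg_distrib]
    have z : ∀ i : Fin (n + 3), ¬ (Fin.last (n + 1)).succ < i := by
      intro i; simp [Fin.le_last]
    simp only [z, if_false, Finset.sum_const_zero, add_zero]
    refine Finset.sum_congr rfl fun j _ => ?_
    rw [Fin.sum_univ_succ, if_neg (by grind), zero_add, ← Finset.sum_neg_distrib]
    refine Finset.sum_congr rfl fun i _ => ?_
    by_cases h : j.castSucc < i
    · rw [if_pos h, if_pos (by grind), hhigh i j h, ← neg_smul]
      congr 1
      simp only [Fin.val_succ, Fin.val_castSucc]
      ring
    · rw [if_neg h, if_neg (by grind), neg_zero]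
  simp only [split, Finset.sum_add_distrib]
  rw [diag, low, high, ← neg_add, ← Finset.sum_add_distrib, ← sub_eq_add_neg]
  congr 1
  refine Finset.sum_congr rfl fun i _ => ?_
  rw [← Finset.sum_add_distrib]
  refine Finset.sum_congr rfl fun j _ => ?_
  by_cases h : i ≤ j.castSucc
  · rw [if_pos h, if_neg (not_lt.2 h), add_zero]
  · rw [if_neg h, if_pos (not_le.1 h), zero_add]

/-- An alternating double sum of terms satisfying the simplicial identity vanishes. -/
lemma sum_faces_faces_eq_zero {M : Type*} [AddCommGroup M] [Module ℝ M] {n : ℕ}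
    (β : Fin (n + 2) → Fin (n + 1) → M)
    (h : ∀ i j : Fin (n + 1), i ≤ j → β i.castSucc j = β j.succ i) :
    ∑ i : Fin (n + 2), ∑ j : Fin (n + 1),
      ((-1 : ℝ) ^ (i : ℕ) * (-1) ^ (j : ℕ)) • β i j = 0 := by
  classical
  have low : (∑ j : Fin (n + 1), ∑ i : Fin (n + 2), if i ≤ j.castSucc then
      ((-1 : ℝ) ^ (i : ℕ) * (-1) ^ (j : ℕ)) • β i j else 0) =
      -∑ j : Fin (n + 1), ∑ i : Fin (n + 2), if i ≤ j.castSucc then 0 else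
        ((-1 : ℝ) ^ (i : ℕ) * (-1) ^ (j : ℕ)) • β i j := by
    have e : ∀ j : Fin (n + 1), (∑ i : Fin (n + 2), if i ≤ j.castSucc then
        ((-1 : ℝ) ^ (i : ℕ) * (-1) ^ (j : ℕ)) • β i j else 0) =
        ∑ i : Fin (n + 1), if i ≤ j then
          ((-1 : ℝ) ^ (i : ℕ) * (-1) ^ (j : ℕ)) • β i.castSucc j else 0 := by
      intro j
      rw [Fin.sum_univ_castSucc, if_neg (by grind), add_zero]
      simp
    simp only [e]
    rw [Finset.sum_comm, ← Finset.sum_neg_distrib]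
    refine Finset.sum_congr rfl fun i _ => ?_
    rw [Fin.sum_univ_succ (n := n + 1), if_pos (by simp), zero_add, ← Finset.sum_neg_distrib]
    refine Finset.sum_congr rfl fun j _ => ?_
    by_cases hij : i ≤ j
    · rw [if_pos hij, if_neg (by grind), h i j hij, ← neg_smul]
      congr 1
      simp only [Fin.val_succ]
      ring
    · rw [if_neg hij, if_pos (by grind), neg_zero]
  rw [Finset.sum_comm]
  have e : ∀ (j : Fin (n + 1)) (i : Fin (n + 2)),
      ((-1 : ℝ) ^ (i : ℕ) * (-1) ^ (j : ℕ)) • β i j =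
      (if i ≤ j.castSucc then ((-1 : ℝ) ^ (i : ℕ) * (-1) ^ (j : ℕ)) • β i j else 0) +
      (if i ≤ j.castSucc then 0 else ((-1 : ℝ) ^ (i : ℕ) * (-1) ^ (j : ℕ)) • β i j) := by
    intro j i
    split_ifs <;> simp
  rw [Finset.sum_congr rfl fun j _ => Finset.sum_congr rfl fun i _ => e j i]
  simp only [Finset.sum_add_distrib]
  rw [low, neg_add_cancel]

/-! ### Boundary, push-forward and the prism operator -/

section Chains

variable {X Y Z : Type*} [TopologicalSpace X] [TopologicalSpace Y] [TopologicalSpace Z]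

lemma boundary_single {n : ℕ} (σ : SingularSimplex X (n + 1)) (r : ℝ) :
    boundary ℝ X n (Finsupp.single σ r) =
      ∑ i : Fin (n + 2), Finsupp.single (σ.comp (coface i)) (r * (-1 : ℝ) ^ (i : ℕ)) := by
  simp [boundary, boundaryOf, Finset.smul_sum]

lemma pushChain_single (f : C(X, Y)) {n : ℕ} (σ : SingularSimplex X n) (r : ℝ) :
    pushChain ℝ f n (Finsupp.single σ r) = Finsupp.single (f.comp σ) r := by
  simp [pushChain]

lemma pushChain_comp (g : C(Y, Z)) (f : C(X, Y)) {n : ℕ} (c : SingularChain ℝ X n) :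
    pushChain ℝ (g.comp f) n c = pushChain ℝ g n (pushChain ℝ f n c) := by
  induction c using Finsupp.induction_linear with
  | zero => simp
  | add c d hc hd => simp only [map_add, hc, hd]
  | single σ r => simp only [pushChain_single, ContinuousMap.comp_assoc]

lemma pushChain_id {n : ℕ} (c : SingularChain ℝ X n) :
    pushChain ℝ (ContinuousMap.id X) n c = c := by
  induction c using Finsupp.induction_linear with
  | zero => simp
  | add c d hc hd => simp only [map_add, hc, hd]
  | single σ r => simp only [pushChain_single, ContinuousMap.id_comp]

lemma boundary_pushChain (f : C(X, Y)) {n : ℕ} (c : SingularChain ℝ X (n + 1)) :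
    boundary ℝ Y n (pushChain ℝ f (n + 1) c) = pushChain ℝ f n (boundary ℝ X n c) := by
  induction c using Finsupp.induction_linear with
  | zero => simp
  | add c d hc hd => simp only [map_add, hc, hd]
  | single σ r => simp only [pushChain_single, boundary_single, map_sum, ContinuousMap.comp_assoc]

lemma coface_eq_map {n : ℕ} (i : Fin (n + 2)) (x : TopSimplex n) :
    coface i x = stdSimplex.map i.succAbove x := by
  apply Subtype.ext
  funext j
  change cofaceFun i x j = FunOnFinite.linearMap ℝ ℝ i.succAbove x j
  rw [FunOnFinite.linearMap_apply_apply, cofaceFun, Finset.sum_filter]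

lemma coface_comp_coface {n : ℕ} {i j : Fin (n + 2)} (h : i ≤ j) :
    (coface i.castSucc).comp (coface j) = (coface j.succ).comp (coface (n := n) i) := by
  ext1 x
  simp only [ContinuousMap.comp_apply, coface_eq_map, stdSimplex.map_comp_apply]
  congr 1
  funext k
  simp only [Function.comp_apply]
  grind [Fin.succAbove]

lemma boundary_boundary {n : ℕ} (c : SingularChain ℝ X (n + 2)) :
    boundary ℝ X n (boundary ℝ X (n + 1) c) = 0 := by
  induction c using Finsupp.induction_linear with
  | zero => simp
  | add c d hc hd => simp only [map_add, hc, hd, add_zero]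
  | single σ r =>
    simp only [boundary_single, map_sum, ContinuousMap.comp_assoc]
    have := sum_faces_faces_eq_zero
      (fun i j => Finsupp.single (σ.comp ((coface i).comp (coface (n := n) j))) r)
      (fun i j h => by simp only [coface_comp_coface h])
    rw [← this]
    refine Finset.sum_congr rfl fun i _ => Finset.sum_congr rfl fun j _ => ?_
    rw [Finsupp.smul_single, smul_eq_mul]
    congr 1
    ring

/-- The total barycentric weight of the vertices in `S`. -/
def faceWeight {n : ℕ} (S : Finset (Fin (n + 1))) : C(TopSimplex n, unitInterval) where
  toFun x := ⟨∑ k ∈ S, (x : Fin (n + 1) → ℝ) k, Finset.sum_nonneg fun k _ => x.2.1 k,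
    (Finset.sum_le_sum_of_subset_of_nonneg (Finset.subset_univ S) fun k _ _ => x.2.1 k).trans_eq
      x.2.2⟩
  continuous_toFun := by
    refine Continuous.subtype_mk (continuous_finsetSum _ fun k _ => ?_) _
    exact (continuous_apply k).comp continuous_subtype_val

lemma faceWeight_empty {n : ℕ} (x : TopSimplex n) : faceWeight ∅ x = 0 := by
  apply Subtype.ext
  simp [faceWeight]

lemma faceWeight_univ {n : ℕ} (x : TopSimplex n) : faceWeight Finset.univ x = 1 := by
  apply Subtype.ext
  exact x.2.2

lemma faceWeight_eq_zero_iff {n : ℕ} (S : Finset (Fin (n + 1))) (x : TopSimplex n) :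
    faceWeight S x = 0 ↔ x ∈ faceSet n Sᶜ := by
  rw [Subtype.ext_iff]
  change ∑ k ∈ S, x.1 k = 0 ↔ _
  rw [Finset.sum_eq_zero_iff_of_nonneg fun k _ => x.2.1 k]
  simp only [faceSet, Set.mem_ofPred_eq, Finset.mem_compl, not_not]
  rfl

lemma faceWeight_coface {n : ℕ} (S : Finset (Fin (n + 2))) (i : Fin (n + 2)) (x : TopSimplex n) :
    faceWeight S (coface i x) = faceWeight (Finset.univ.filter fun k => i.succAbove k ∈ S) x := by
  apply Subtype.ext
  change ∑ j ∈ S, cofaceFun i x j = ∑ k with i.succAbove k ∈ S, (x : Fin (n + 1) → ℝ) k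
  unfold cofaceFun
  rw [Finset.sum_comm, Finset.sum_filter]
  exact Finset.sum_congr rfl fun k _ => by rw [Finset.sum_ite_eq]

/-- The singular simplex `x ↦ H (σ (g x), t)` in the target of a homotopy `H`, where `g` acts
linearly on barycentric coordinates and `t` is the total weight of the vertices in `S`. -/
def homotopySimplex (H : C(X × unitInterval, Y)) {m n : ℕ} (σ : SingularSimplex X n)
    (g : Fin (m + 1) → Fin (n + 1)) (S : Finset (Fin (m + 1))) : SingularSimplex Y m :=
  H.comp ((σ.comp ⟨stdSimplex.map g, stdSimplex.continuous_map g⟩).prodMk (faceWeight S))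

lemma homotopySimplex_apply (H : C(X × unitInterval, Y)) {m n : ℕ} (σ : SingularSimplex X n)
    (g : Fin (m + 1) → Fin (n + 1)) (S : Finset (Fin (m + 1))) (x : TopSimplex m) :
    homotopySimplex H σ g S x = H (σ (stdSimplex.map g x), faceWeight S x) := rfl

lemma homotopySimplex_comp_coface (H : C(X × unitInterval, Y)) {m n : ℕ}
    (σ : SingularSimplex X n) (g : Fin (m + 2) → Fin (n + 1)) (S : Finset (Fin (m + 2)))
    (i : Fin (m + 2)) :
    (homotopySimplex H σ g S).comp (coface i) =
      homotopySimplex H σ (g ∘ i.succAbove)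
        (Finset.univ.filter fun k => i.succAbove k ∈ S) := by
  ext1 x
  simp only [ContinuousMap.comp_apply, homotopySimplex_apply, faceWeight_coface]
  simp only [coface_eq_map, stdSimplex.map_comp_apply]

lemma homotopySimplex_coface (H : C(X × unitInterval, Y)) {m n : ℕ}
    (σ : SingularSimplex X (n + 1)) (g : Fin (m + 1) → Fin (n + 1)) (S : Finset (Fin (m + 1)))
    (i : Fin (n + 2)) :
    homotopySimplex H (σ.comp (coface i)) g S = homotopySimplex H σ (i.succAbove ∘ g) S := by
  ext1 x
  simp only [ContinuousMap.comp_apply, homotopySimplex_apply, coface_eq_map,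
    stdSimplex.map_comp_apply]

/-- The map at time `t` of a homotopy. -/
def homotopyAt (H : C(X × unitInterval, Y)) (t : unitInterval) : C(X, Y) :=
  H.comp ((ContinuousMap.id X).prodMk (ContinuousMap.const X t))

lemma homotopyAt_apply (H : C(X × unitInterval, Y)) (t : unitInterval) (x : X) :
    homotopyAt H t x = H (x, t) := rfl

/-- The `j`-th simplex `[v₀, …, vⱼ, wⱼ, …, wₙ]` of the prism over `σ`. -/
def prismSimplex (H : C(X × unitInterval, Y)) {n : ℕ} (σ : SingularSimplex X n)
    (j : Fin (n + 1)) : SingularSimplex Y (n + 1) :=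
  homotopySimplex H σ j.predAbove (Finset.univ.filter fun k => j.castSucc < k)

lemma prismSimplex_zero_comp_coface_zero (H : C(X × unitInterval, Y)) {n : ℕ}
    (σ : SingularSimplex X n) :
    (prismSimplex H σ 0).comp (coface 0) = (homotopyAt H 1).comp σ := by
  rw [prismSimplex, homotopySimplex_comp_coface]
  have hg : (0 : Fin (n + 1)).predAbove ∘ (0 : Fin (n + 2)).succAbove = id := by
    funext k; simp
  have hS : (Finset.univ.filter fun k : Fin (n + 1) => (0 : Fin (n + 2)).succAbove k ∈
      Finset.univ.filter fun k => (0 : Fin (n + 1)).castSucc < k) = Finset.univ := by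
    ext k
    simp only [Finset.mem_filter_univ, Finset.mem_univ, iff_true]
    exact Fin.succ_pos k
  rw [hg, hS]
  ext1 x
  simp [homotopySimplex_apply, homotopyAt_apply, faceWeight_univ]

lemma prismSimplex_last_comp_coface_last (H : C(X × unitInterval, Y)) {n : ℕ}
    (σ : SingularSimplex X n) :
    (prismSimplex H σ (Fin.last n)).comp (coface (Fin.last (n + 1))) =
      (homotopyAt H 0).comp σ := by
  rw [prismSimplex, homotopySimplex_comp_coface]
  have hg : (Fin.last n).predAbove ∘ (Fin.last (n + 1)).succAbove = id := by
    funext k; simp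
  have hS : (Finset.univ.filter fun k : Fin (n + 1) => (Fin.last (n + 1)).succAbove k ∈
      Finset.univ.filter fun k => (Fin.last n).castSucc < k) = ∅ := by
    ext k; simp [Fin.le_last]
  rw [hg, hS]
  ext1 x
  simp [homotopySimplex_apply, homotopyAt_apply, faceWeight_empty]

/-- The prism operator of a homotopy. -/
def prism (H : C(X × unitInterval, Y)) (n : ℕ) :
    SingularChain ℝ X n →ₗ[ℝ] SingularChain ℝ Y (n + 1) :=
  Finsupp.lsum ℕ fun σ => LinearMap.toSpanSingleton ℝ _
    (∑ j : Fin (n + 1), Finsupp.single (prismSimplex H σ j) ((-1 : ℝ) ^ (j : ℕ)))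

lemma prism_single (H : C(X × unitInterval, Y)) {n : ℕ} (σ : SingularSimplex X n) (r : ℝ) :
    prism H n (Finsupp.single σ r) =
      ∑ j : Fin (n + 1), Finsupp.single (prismSimplex H σ j) (r * (-1 : ℝ) ^ (j : ℕ)) := by
  simp [prism, Finset.smul_sum]

lemma boundary_prism_zero (H : C(X × unitInterval, Y)) (c : SingularChain ℝ X 0) :
    boundary ℝ Y 0 (prism H 0 c) =
      pushChain ℝ (homotopyAt H 1) 0 c - pushChain ℝ (homotopyAt H 0) 0 c := by
  induction c using Finsupp.induction_linear with
  | zero => simp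
  | add c d hc hd => simp only [map_add, hc, hd]; abel
  | single σ r =>
    have h0 := prismSimplex_zero_comp_coface_zero H σ
    have h1 := prismSimplex_last_comp_coface_last H σ
    rw [prism_single, Fin.sum_univ_succ, Fin.sum_univ_zero, add_zero, boundary_single,
      Fin.sum_univ_succ, Fin.sum_univ_succ, Fin.sum_univ_zero, add_zero, pushChain_single,
      pushChain_single, ← h0, ← h1, sub_eq_add_neg, ← Finsupp.single_neg]
    congr 2
    · simp
    · simp

lemma boundary_prism_succ (H : C(X × unitInterval, Y)) {n : ℕ}
    (c : SingularChain ℝ X (n + 1)) :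
    boundary ℝ Y (n + 1) (prism H (n + 1) c) =
      pushChain ℝ (homotopyAt H 1) (n + 1) c - pushChain ℝ (homotopyAt H 0) (n + 1) c -
        prism H n (boundary ℝ X n c) := by
  induction c using Finsupp.induction_linear with
  | zero => simp
  | add c d hc hd => simp only [map_add, hc, hd]; abel
  | single σ r =>
    have key := sum_prism_faces
      (fun i j => Finsupp.single ((prismSimplex H σ j).comp (coface i)) r)
      (fun i j => Finsupp.single (prismSimplex H (σ.comp (coface i)) j) r)
      (fun i j h => by
        simp only [prismSimplex, homotopySimplex_comp_coface, homotopySimplex_coface]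
        congr 2
        · funext k; grind [Fin.succAbove, Fin.predAbove, Fin.coe_castPred]
        · ext k; grind [Fin.succAbove])
      (fun j => by
        simp only [prismSimplex, homotopySimplex_comp_coface]
        congr 2
        · funext k; grind [Fin.succAbove, Fin.predAbove, Fin.coe_castPred]
        · ext k; grind [Fin.succAbove])
      (fun i j h => by
        simp only [prismSimplex, homotopySimplex_comp_coface, homotopySimplex_coface]
        congr 2
        · funext k; grind [Fin.succAbove, Fin.predAbove, Fin.coe_castPred]
        · ext k; grind [Fin.succAbove])
    simp only [prismSimplex_zero_comp_coface_zero, prismSimplex_last_comp_coface_last,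
      Finsupp.smul_single, smul_eq_mul] at key
    simp only [prism_single, boundary_single, pushChain_single, map_sum, mul_assoc,
      mul_comm r]
    simpa only [mul_assoc, mul_comm, mul_left_comm] using key

lemma single_mem_admissibleChains {B : Set X} {n : ℕ} {σ : SingularSimplex X n}
    (h : Admissible B σ) (r : ℝ) : Finsupp.single σ r ∈ admissibleChains ℝ X B n := by
  have := (admissibleChains ℝ X B n).smul_mem r (Submodule.subset_span ⟨σ, h, rfl⟩)
  simpa using this

lemma single_mem_chainsIn {B : Set X} {n : ℕ} {σ : SingularSimplex X n}
    (h : Set.range σ ⊆ B) (r : ℝ) : Finsupp.single σ r ∈ chainsIn ℝ X B n := by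
  have := (chainsIn ℝ X B n).smul_mem r (Submodule.subset_span ⟨σ, h, rfl⟩)
  simpa using this

lemma admissible_of_forall_notMem {B : Set X} {n : ℕ} {σ : SingularSimplex X n}
    (h : ∀ x, σ x ∉ B) : Admissible B σ :=
  ⟨∅, by ext x; simp [h]⟩

lemma Admissible.comp {A : Set X} {B : Set Y} {f : C(X, Y)} (hf : f ⁻¹' B = A) {n : ℕ}
    {σ : SingularSimplex X n} (h : Admissible A σ) : Admissible B (f.comp σ) := by
  unfold Admissible at *
  rwa [ContinuousMap.coe_comp, Set.preimage_comp, hf]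

lemma pushChain_mem_admissibleChains {A : Set X} {B : Set Y} {f : C(X, Y)} (hf : f ⁻¹' B = A)
    {n : ℕ} {c : SingularChain ℝ X n} (hc : c ∈ admissibleChains ℝ X A n) :
    pushChain ℝ f n c ∈ admissibleChains ℝ Y B n := by
  suffices h : admissibleChains ℝ X A n ≤
      (admissibleChains ℝ Y B n).comap (pushChain ℝ f n) from h hc
  refine Submodule.span_le.2 ?_
  rintro _ ⟨σ, hσ, rfl⟩
  simp only [Submodule.comap_coe, Set.mem_preimage, pushChain_single]
  exact single_mem_admissibleChains (hσ.comp hf) 1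

lemma pushChain_mem_chainsIn {A : Set X} {B : Set Y} {f : C(X, Y)} (hf : Set.MapsTo f A B)
    {n : ℕ} {c : SingularChain ℝ X n} (hc : c ∈ chainsIn ℝ X A n) :
    pushChain ℝ f n c ∈ chainsIn ℝ Y B n := by
  suffices h : chainsIn ℝ X A n ≤ (chainsIn ℝ Y B n).comap (pushChain ℝ f n) from h hc
  refine Submodule.span_le.2 ?_
  rintro _ ⟨σ, hσ, rfl⟩
  simp only [Submodule.comap_coe, Set.mem_preimage, pushChain_single]
  refine single_mem_chainsIn ?_ 1
  rintro _ ⟨x, rfl⟩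
  exact hf (hσ ⟨x, rfl⟩)

lemma pushChain_mem_markedCycles {A : Set X} {B : Set Y} {f : C(X, Y)} (hf : f ⁻¹' B = A)
    {n : ℕ} {c : SingularChain ℝ X n} (hc : c ∈ markedCycles ℝ X A n) :
    pushChain ℝ f n c ∈ markedCycles ℝ Y B n := by
  cases n with
  | zero => exact pushChain_mem_admissibleChains hf hc
  | succ n =>
    refine ⟨pushChain_mem_admissibleChains hf hc.1, ?_⟩
    change boundary ℝ Y n _ ∈ chainsIn ℝ Y B n
    rw [boundary_pushChain]
    exact pushChain_mem_chainsIn (fun x hx => by rw [← hf] at hx; exact hx) hc.2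

lemma boundary_mem_relativeBoundaries {B : Set X} {n : ℕ} (c : SingularChain ℝ X (n + 1)) :
    boundary ℝ X n c ∈ relativeBoundaries ℝ X B n :=
  Submodule.mem_sup_left ⟨c, trivial, rfl⟩

lemma pushChain_mem_relativeBoundaries {A : Set X} {B : Set Y} {f : C(X, Y)}
    (hf : Set.MapsTo f A B) {n : ℕ} {c : SingularChain ℝ X n}
    (hc : c ∈ relativeBoundaries ℝ X A n) :
    pushChain ℝ f n c ∈ relativeBoundaries ℝ Y B n := by
  obtain ⟨_, ⟨b, -, rfl⟩, a, ha, rfl⟩ := Submodule.mem_sup.1 hc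
  rw [map_add, ← boundary_pushChain]
  exact add_mem (boundary_mem_relativeBoundaries _)
    (Submodule.mem_sup_right (pushChain_mem_chainsIn hf ha))

lemma prism_mem_chainsIn {A : Set X} {B : Set Y} {H : C(X × unitInterval, Y)}
    (hH : ∀ x ∈ A, ∀ t, H (x, t) ∈ B) {n : ℕ} {c : SingularChain ℝ X n}
    (hc : c ∈ chainsIn ℝ X A n) : prism H n c ∈ chainsIn ℝ Y B (n + 1) := by
  suffices h : chainsIn ℝ X A n ≤ (chainsIn ℝ Y B (n + 1)).comap (prism H n) from h hc
  refine Submodule.span_le.2 ?_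
  rintro _ ⟨σ, hσ, rfl⟩
  simp only [Submodule.comap_coe, Set.mem_preimage, prism_single]
  refine sum_mem fun j _ => single_mem_chainsIn ?_ _
  rintro _ ⟨x, rfl⟩
  exact hH _ (hσ ⟨_, rfl⟩) _

/-- A prism over a simplex in `A` is admissible if the homotopy leaves `B` immediately. -/
lemma prism_mem_admissibleChains {A : Set X} {B : Set Y} {H : C(X × unitInterval, Y)}
    (hH : ∀ x ∈ A, ∀ t, H (x, t) ∈ B ↔ t = 0) {n : ℕ} {c : SingularChain ℝ X n}
    (hc : c ∈ chainsIn ℝ X A n) : prism H n c ∈ admissibleChains ℝ Y B (n + 1) := by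
  suffices h : chainsIn ℝ X A n ≤ (admissibleChains ℝ Y B (n + 1)).comap (prism H n) from h hc
  refine Submodule.span_le.2 ?_
  rintro _ ⟨σ, hσ, rfl⟩
  simp only [Submodule.comap_coe, Set.mem_preimage, prism_single]
  refine sum_mem fun j _ => single_mem_admissibleChains ?_ _
  refine ⟨{(Finset.univ.filter fun k => j.castSucc < k)ᶜ}, ?_⟩
  ext x
  rw [Set.biUnion_singleton, ← faceWeight_eq_zero_iff]
  exact hH _ (hσ ⟨_, rfl⟩) _

/-- Homotopic maps of pairs agree on relative homology. -/
lemma pushChain_sub_mem_relativeBoundaries {A : Set X} {B : Set Y} {H : C(X × unitInterval, Y)}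
    (hH : ∀ x ∈ A, ∀ t, H (x, t) ∈ B) {n : ℕ} {c : SingularChain ℝ X n}
    (hc : c ∈ relativeCycles ℝ X A n) :
    pushChain ℝ (homotopyAt H 1) n c - pushChain ℝ (homotopyAt H 0) n c ∈
      relativeBoundaries ℝ Y B n := by
  cases n with
  | zero =>
    rw [← boundary_prism_zero]
    exact boundary_mem_relativeBoundaries _
  | succ n =>
    rw [← sub_add_cancel (_ - _) (prism H n (boundary ℝ X n c)), ← boundary_prism_succ]
    exact add_mem (boundary_mem_relativeBoundaries _)
      (Submodule.mem_sup_right (prism_mem_chainsIn hH hc))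

/-- A homotopy that starts at the identity and immediately leaves `A` deforms relative cycles
to marked cycles. -/
lemma exists_markedCycle_sub_mem_relativeBoundaries {A : Set X} {H : C(X × unitInterval, X)}
    (hH0 : ∀ x, H (x, 0) = x) (hH : ∀ x t, H (x, t) ∈ A ↔ x ∈ A ∧ t = 0) {n : ℕ}
    {c : SingularChain ℝ X n} (hc : c ∈ relativeCycles ℝ X A n) :
    ∃ z ∈ markedCycles ℝ X A n, z - c ∈ relativeBoundaries ℝ X A n := by
  have hid : pushChain ℝ (homotopyAt H 0) n c = c := by
    have : homotopyAt H 0 = ContinuousMap.id X := by ext1 x; exact hH0 x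
    rw [this, pushChain_id]
  have hpush : pushChain ℝ (homotopyAt H 1) n c ∈ admissibleChains ℝ X A n := by
    clear hc hid
    induction c using Finsupp.induction_linear with
    | zero => simp
    | add c d hc hd => rw [map_add]; exact add_mem hc hd
    | single σ r =>
      rw [pushChain_single]
      refine single_mem_admissibleChains (admissible_of_forall_notMem fun x hx => ?_) r
      exact one_ne_zero ((hH _ _).1 hx).2
  refine ⟨c + boundary ℝ X n (prism H n c), ?_, by
    rw [add_sub_cancel_left]; exact boundary_mem_relativeBoundaries _⟩
  cases n with
  | zero =>
    rw [boundary_prism_zero, hid, add_sub_cancel]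
    exact hpush
  | succ n =>
    constructor
    · rw [boundary_prism_succ, hid, sub_right_comm, add_sub_cancel]
      exact sub_mem hpush (prism_mem_admissibleChains (fun x hx t => by simp [hH, hx]) hc)
    · change boundary ℝ X n _ ∈ chainsIn ℝ X A n
      rw [map_add, boundary_boundary, add_zero]
      exact hc

lemma l1Norm_nonneg {n : ℕ} (c : SingularChain ℝ X n) : 0 ≤ l1Norm c :=
  Finset.sum_nonneg fun _ _ => abs_nonneg _

lemma l1Norm_smul {n : ℕ} (r : ℝ) (c : SingularChain ℝ X n) :
    l1Norm (r • c) = |r| * l1Norm c := by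
  unfold l1Norm
  rw [Finsupp.sum_smul_index (by simp), Finsupp.mul_sum]
  simp only [abs_mul]

lemma l1Norm_add_le {n : ℕ} (c d : SingularChain ℝ X n) :
    l1Norm (c + d) ≤ l1Norm c + l1Norm d := by
  classical
  have e : ∀ b : SingularChain ℝ X n, b.support ⊆ c.support ∪ d.support →
      l1Norm b = ∑ σ ∈ c.support ∪ d.support, |b σ| := fun b hb =>
    Finsupp.sum_of_support_subset _ hb _ (by simp)
  rw [e _ Finsupp.support_add, e _ Finset.subset_union_left, e _ Finset.subset_union_right,
    ← Finset.sum_add_distrib]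
  exact Finset.sum_le_sum fun σ _ => abs_add_le _ _

lemma l1Norm_pushChain_le (f : C(X, Y)) {n : ℕ} (c : SingularChain ℝ X n) :
    l1Norm (pushChain ℝ f n c) ≤ l1Norm c := by
  classical
  induction c using Finsupp.induction with
  | zero => simp [l1Norm]
  | single_add σ r c hσ hr ih =>
    have h : l1Norm (Finsupp.single σ r + c) = |r| + l1Norm c := by
      unfold l1Norm
      rw [Finsupp.sum_add_index_of_disjoint, Finsupp.sum_single_index (by simp)]
      rw [Finsupp.support_single _ hr]
      simpa using hσ
    have h' : l1Norm (pushChain ℝ f n (Finsupp.single σ r)) = |r| := by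
      rw [pushChain_single, l1Norm, Finsupp.sum_single_index (by simp)]
    rw [h, map_add]
    exact (l1Norm_add_le _ _).trans (add_le_add h'.le ih)

end Chains


/-- Glue a map on a closed subspace with a map on the ambient space that agrees with it outside
of an open subset. -/
lemma Topology.IsClosedEmbedding.exists_glue {A X Z : Type*} [TopologicalSpace A]
    [TopologicalSpace X] [TopologicalSpace Z] {φ : A → X} (hφ : IsClosedEmbedding φ) {U : Set A}
    (hU : IsOpen (φ '' U)) (h : C(A, Z)) (k : C(X, Z)) (hk : ∀ a ∉ U, h a = k (φ a)) :
    ∃ F : C(X, Z), (∀ a, F (φ a) = h a) ∧ ∀ x ∉ Set.range φ, F x = k x := by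
  classical
  let F : X → Z := fun x => if hx : ∃ a, φ a = x then h hx.choose else k x
  have hF : ∀ a, F (φ a) = h a := fun a => by
    have hx : ∃ b, φ b = φ a := ⟨a, rfl⟩
    simp only [F, dif_pos hx, hφ.injective hx.choose_spec]
  have hF' : ∀ x ∉ Set.range φ, F x = k x := fun x hx => dif_neg hx
  have h1 : ContinuousOn F (Set.range φ) := by
    rw [continuousOn_iff_continuous_domRestrict, ← Homeomorph.comp_continuous_iff'
      hφ.isEmbedding.toHomeomorph]
    exact h.continuous.congr fun a => (hF a).symm
  have h2 : ContinuousOn F (φ '' U)ᶜ := by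
    refine k.continuous.continuousOn.congr fun x hx => ?_
    by_cases hr : x ∈ Set.range φ
    · obtain ⟨a, rfl⟩ := hr
      rw [hF, hk a fun ha => hx ⟨a, ha, rfl⟩]
    · exact hF' x hr
  refine ⟨⟨F, ?_⟩, hF, hF'⟩
  have h3 := h1.union_of_isClosed h2 hφ.isClosed_range hU.isClosed_compl
  rwa [show Set.range φ ∪ (φ '' U)ᶜ = Set.univ from
    Set.eq_univ_of_forall fun x => or_iff_not_imp_right.2 fun hx =>
      Set.image_subset_range _ _ (not_not.1 hx), continuousOn_univ] at h3

section Collar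

variable {X Y : Type*} [TopologicalSpace X] [TopologicalSpace Y]

/-- A thin enough open sub-collar is open in the ambient space. -/
lemma exists_isOpen_image_collar {bd : Set X} (hbd : IsCompact bd)
    {φ : C(bd × unitInterval, X)} (hφ : IsClosedEmbedding φ) (hφ0 : ∀ x : bd, φ (x, 0) = x)
    (hr : Set.range φ ∈ nhdsSet bd) :
    ∃ δ : unitInterval, 0 < δ ∧ IsOpen (φ '' {p | p.2 < δ}) := by
  have : CompactSpace bd := isCompact_iff_compactSpace.1 hbd
  have hsub : bd ⊆ interior (Set.range φ) := subset_interior_iff_mem_nhdsSet.2 hr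
  obtain ⟨u, v, -, hv, hu, h0, huv⟩ := generalized_tube_lemma (isCompact_univ (X := bd))
    (isCompact_singleton (x := (0 : unitInterval)))
    (isOpen_interior.preimage φ.continuous) (by
      rintro ⟨x, t⟩ ⟨-, rfl⟩
      exact hsub (by rw [hφ0]; exact x.2))
  obtain ⟨δ, hδ, hδv⟩ := exists_Ico_subset_of_mem_nhds (hv.mem_nhds (h0 rfl))
    ⟨1, zero_lt_one⟩
  refine ⟨δ, hδ, ?_⟩
  obtain ⟨O, hO, hO'⟩ := hφ.isInducing.isOpen_iff.1
    (isOpen_lt (continuous_snd (X := bd)) (continuous_const (y := δ)))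
  have : φ '' {p | p.2 < δ} = O ∩ interior (Set.range φ) := by
    rw [← hO']
    ext x
    constructor
    · rintro ⟨p, hp, rfl⟩
      refine ⟨hp, @huv p ⟨hu trivial, hδv ⟨p.2.2.1, ?_⟩⟩⟩
      rw [hO'] at hp
      exact hp
    · rintro ⟨hx, hx'⟩
      obtain ⟨p, rfl⟩ := interior_subset hx'
      exact ⟨p, hx, rfl⟩
  rw [this]
  exact hO.inter isOpen_interior

/-- The boundary of a collared space is the zero set of a continuous function. -/
lemma HasBoundaryCollar.exists_eq_zero_iff {bd : Set X} (h : HasBoundaryCollar X bd)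
    (hbd : IsCompact bd) : ∃ s : C(X, unitInterval), ∀ x, s x = 0 ↔ x ∈ bd := by
  obtain ⟨φ, hφ, hφ0, hr, hφbd⟩ := h
  obtain ⟨δ, hδ, hU⟩ := exists_isOpen_image_collar hbd hφ hφ0 hr
  obtain ⟨s, hs, hs'⟩ := hφ.exists_glue hU
    (⟨fun p => min p.2 δ, by fun_prop⟩ : C(bd × unitInterval, unitInterval))
    (ContinuousMap.const X δ) fun p hp => min_eq_right (not_lt.1 hp)
  refine ⟨s, fun x => ?_⟩
  by_cases hx : x ∈ Set.range φ
  · obtain ⟨⟨y, t⟩, rfl⟩ := hx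
    rw [hs, hφbd]
    change min t δ = 0 ↔ t = 0
    rcases min_cases t δ with ⟨e, -⟩ | ⟨e, hlt⟩
    · rw [e]
    · rw [e]
      exact iff_of_false hδ.ne' (hδ.trans hlt).ne'
  · rw [hs' x hx]
    exact iff_of_false hδ.ne' fun hb => hx ⟨(⟨x, hb⟩, 0), hφ0 _⟩

/-- A collared space can be pushed off its boundary into the interior. -/
lemma HasBoundaryCollar.exists_push {bd : Set X} (h : HasBoundaryCollar X bd)
    (hbd : IsCompact bd) : ∃ H : C(X × unitInterval, X),
      (∀ x, H (x, 0) = x) ∧ ∀ x t, H (x, t) ∈ bd ↔ x ∈ bd ∧ t = 0 := by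
  obtain ⟨φ, hφ, hφ0, hr, hφbd⟩ := h
  obtain ⟨δ, hδ, hU⟩ := exists_isOpen_image_collar hbd hφ hφ0 hr
  have hΦ : IsClosedEmbedding (Prod.map φ (id : unitInterval → unitInterval)) :=
    hφ.prodMap .id
  have hU' : IsOpen (Prod.map φ (id : unitInterval → unitInterval) ''
      ({p | p.2 < δ} ×ˢ Set.univ)) := by
    rw [Set.prodMap_image_prod]
    exact hU.prod (by simp)
  obtain ⟨H, hH, hH'⟩ := hΦ.exists_glue hU'
    (⟨fun p => φ (p.1.1, max p.1.2 (p.2 * δ)), by fun_prop⟩ :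
      C((bd × unitInterval) × unitInterval, X))
    ⟨Prod.fst, continuous_fst⟩ (by
      rintro ⟨⟨y, t⟩, s⟩ hp
      have ht : δ ≤ t := not_lt.1 fun ht => hp ⟨ht, trivial⟩
      change φ (y, max t (s * δ)) = φ (y, t)
      rw [max_eq_left (unitInterval.mul_le_right.trans ht)])
  have hH₁ : ∀ y t s, H (φ (y, t), s) = φ (y, max t (s * δ)) := fun y t s => hH ((y, t), s)
  have hH₂ : ∀ x ∉ Set.range φ, ∀ s, H (x, s) = x := fun x hx s => hH' (x, s) (by
    rintro ⟨⟨p, _⟩, hp⟩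
    exact hx ⟨p, congrArg Prod.fst hp⟩)
  refine ⟨H, fun x => ?_, fun x s => ?_⟩ <;> by_cases hx : x ∈ Set.range φ
  · obtain ⟨⟨y, t⟩, rfl⟩ := hx
    rw [hH₁, zero_mul, max_eq_left unitInterval.nonneg']
  · exact hH₂ x hx 0
  · obtain ⟨⟨y, t⟩, rfl⟩ := hx
    rw [hH₁, hφbd, hφbd]
    constructor
    · intro e
      refine ⟨le_antisymm ((le_max_left _ _).trans e.le) t.2.1, ?_⟩
      have : s * δ = 0 := le_antisymm ((le_max_right _ _).trans e.le) (s * δ).2.1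
      exact (mul_eq_zero.1 this).resolve_right hδ.ne'
    · rintro ⟨rfl, rfl⟩
      simp
  · rw [hH₂ x hx]
    have : x ∉ bd := fun hb => hx ⟨(⟨x, hb⟩, 0), hφ0 _⟩
    simp [this]

lemma collapseMap_preimage_collapsedBoundary (bd : Set X) :
    collapseMap X bd ⁻¹' collapsedBoundary X bd = bd := by
  refine Set.Subset.antisymm ?_ (Set.subset_preimage_image _ _)
  rintro x ⟨y, hy, hxy⟩
  let p : Collapse X bd → Prop := Quot.lift (· ∈ bd) (by
    rintro a b (rfl | ⟨ha, hb, -⟩)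
    · rfl
    · exact propext (iff_of_true ha hb))
  exact (congrArg p hxy).mp hy

lemma mapsTo_collapseMap (bd : Set X) :
    Set.MapsTo (collapseMap X bd) bd (collapsedBoundary X bd) :=
  Set.mapsTo_image _ _

/-- A map of pairs descends to the collapsed spaces. -/
lemma exists_collapse_map {bdX : Set X} {bdY : Set Y} {g : C(X, Y)}
    (hg : Set.MapsTo g bdX bdY) : ∃ G : C(Collapse X bdX, Collapse Y bdY),
      G.comp (collapseMap X bdX) = (collapseMap Y bdY).comp g := by
  have hrel : ∀ a b, collapseRel X bdX a b → collapseRel Y bdY (g a) (g b) := by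
    rintro a b (rfl | ⟨ha, hb, hab⟩)
    · exact Or.inl rfl
    · refine Or.inr ⟨hg ha, hg hb, connectedComponentIn_eq ?_⟩
      have hsub : g '' connectedComponentIn bdX a ⊆ connectedComponentIn bdY (g a) :=
        (isPreconnected_connectedComponentIn.image g
          g.continuous.continuousOn).subset_connectedComponentIn
          ⟨a, mem_connectedComponentIn ha, rfl⟩
          (Set.image_subset_iff.2 fun x hx => hg (connectedComponentIn_subset _ _ hx))
      exact hsub ⟨b, hab ▸ mem_connectedComponentIn hb, rfl⟩
  exact ⟨⟨Quot.map g hrel, continuous_quot_lift _ (continuous_quot_mk.comp g.continuous)⟩, rfl⟩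

/-- A map of pairs between collared spaces is homotopic, through maps of pairs, to a map that
sends only boundary points to boundary points. -/
lemma exists_homotopy_preimage_eq {bdX : Set X} {bdY : Set Y} (hX : HasBoundaryCollar X bdX)
    (hY : HasBoundaryCollar Y bdY) (hbX : IsCompact bdX) (hbY : IsCompact bdY) {f : C(X, Y)}
    (hf : Set.MapsTo f bdX bdY) : ∃ H : C(X × unitInterval, Y), homotopyAt H 0 = f ∧
      (∀ x ∈ bdX, ∀ t, H (x, t) ∈ bdY) ∧ homotopyAt H 1 ⁻¹' bdY = bdX := by
  obtain ⟨s, hs⟩ := hX.exists_eq_zero_iff hbX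
  obtain ⟨K, hK0, hK⟩ := hY.exists_push hbY
  refine ⟨⟨fun p => K (f p.1, p.2 * s p.1), by fun_prop⟩, ?_, fun x hx t => ?_, ?_⟩
  · ext1 x
    change K (f x, 0 * s x) = f x
    rw [zero_mul, hK0]
  · change K (f x, t * s x) ∈ bdY
    rw [(hs x).2 hx, mul_zero, hK0]
    exact hf hx
  · ext x
    change K (f x, 1 * s x) ∈ bdY ↔ x ∈ bdX
    rw [one_mul, hK, hs]
    exact ⟨And.right, fun hx => ⟨hf hx, hx⟩⟩

/-- The ideal fundamental class is represented by a marked cycle. -/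
lemma exists_idealRepresents {bd : Set X} (h : HasBoundaryCollar X bd) (hbd : IsCompact bd)
    {n : ℕ} {ζ : SingularChain ℝ X n} (hζ : ζ ∈ relativeCycles ℝ X bd n) :
    ∃ z, IdealRepresents X bd n ζ z := by
  obtain ⟨H, hH0, hH⟩ := h.exists_push hbd
  obtain ⟨z, hz, hzζ⟩ := exists_markedCycle_sub_mem_relativeBoundaries hH0 hH hζ
  refine ⟨pushChain ℝ (collapseMap X bd) n z,
    pushChain_mem_markedCycles (collapseMap_preimage_collapsedBoundary bd) hz, ?_⟩
  rw [idealFundamentalRep, ← map_sub]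
  exact pushChain_mem_relativeBoundaries (mapsTo_collapseMap bd) hzζ

end Collar
/-- **Theorem B.** If `f : (M, ∂M) → (N, ∂N)` is a map of pairs between compact connected
oriented `n`-manifolds with boundary, then `‖M‖_I ≥ |deg f| ⬝ ‖N‖_I`. Here the degree of
`f` is the real number `r` with `f_*[M,∂M] = r ⬝ [N,∂N]` in `H_n(N, ∂N; ℝ)`. -/
theorem idealSimplicialVolume_ge_deg_mul {X Y : Type*} [TopologicalSpace X]
    [TopologicalSpace Y] (bdX : Set X) (bdY : Set Y) (n : ℕ)
    (ζX : SingularChain ℝ X n) (ζY : SingularChain ℝ Y n)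
    (hMX : IsCptMfdBdry X bdX n ζX) (hMY : IsCptMfdBdry Y bdY n ζY)
    (f : C(X, Y)) (hf : Set.MapsTo f bdX bdY) (d : ℝ)
    (hdeg : pushChain ℝ f n ζX - d • ζY ∈ relativeBoundaries ℝ Y bdY n) :
    idealSimplicialVolume X bdX n ζX ≥ |d| * idealSimplicialVolume Y bdY n ζY := by
  have := hMX.compact
  have := hMY.compact
  have hbX := hMX.bd_closed.isCompact
  have hbY := hMY.bd_closed.isCompact
  rcases eq_or_ne d 0 with rfl | hd
  · rw [abs_zero, zero_mul]
    refine Real.sInf_nonneg ?_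
    rintro _ ⟨z, -, rfl⟩
    exact l1Norm_nonneg z
  obtain ⟨H, hH0, hHbd, hH1⟩ := exists_homotopy_preimage_eq hMX.collar hMY.collar hbX hbY hf
  have hg : Set.MapsTo (homotopyAt H 1) bdX bdY := fun x hx => hHbd x hx 1
  obtain ⟨G, hG⟩ := exists_collapse_map hg
  have hGbd : G ⁻¹' collapsedBoundary Y bdY = collapsedBoundary X bdX := by
    refine Set.ext fun q => ?_
    induction q using Quot.ind with
    | mk x =>
      have e : G (collapseMap X bdX x) = collapseMap Y bdY (homotopyAt H 1 x) :=
        DFunLike.congr_fun hG x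
      have hx := Set.ext_iff.1 (collapseMap_preimage_collapsedBoundary bdX) x
      have hy := Set.ext_iff.1 (collapseMap_preimage_collapsedBoundary bdY) (homotopyAt H 1 x)
      change G (collapseMap X bdX x) ∈ collapsedBoundary Y bdY ↔
        collapseMap X bdX x ∈ collapsedBoundary X bdX
      rw [e]
      exact (hy.trans (Set.ext_iff.1 hH1 x)).trans hx.symm
  obtain ⟨z₀, hz₀⟩ := exists_idealRepresents hMX.collar hbX hMX.fund.1
  refine le_csInf ⟨_, z₀, hz₀, rfl⟩ ?_
  rintro _ ⟨z, ⟨hz, hzζ⟩, rfl⟩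
  have hdiff : pushChain ℝ G n z - d • idealFundamentalRep Y bdY n ζY ∈
      relativeBoundaries ℝ (Collapse Y bdY) (collapsedBoundary Y bdY) n := by
    have h1 := pushChain_mem_relativeBoundaries
      (fun q hq => by rw [← hGbd] at hq; exact hq) (f := G) hzζ
    have h2 := pushChain_mem_relativeBoundaries (mapsTo_collapseMap bdY)
      (pushChain_sub_mem_relativeBoundaries hHbd hMX.fund.1)
    have h3 := pushChain_mem_relativeBoundaries (mapsTo_collapseMap bdY) hdeg
    have h4 : pushChain ℝ G n (idealFundamentalRep X bdX n ζX) =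
        pushChain ℝ (collapseMap Y bdY) n (pushChain ℝ (homotopyAt H 1) n ζX) := by
      rw [idealFundamentalRep, ← pushChain_comp, hG, pushChain_comp]
    rw [map_sub, h4] at h1
    rw [map_sub, hH0] at h2
    rw [map_sub, map_smul] at h3
    have h5 := add_mem (add_mem h1 h2) h3
    rwa [sub_add_sub_cancel, sub_add_sub_cancel] at h5
  have hrep : IdealRepresents Y bdY n ζY (d⁻¹ • pushChain ℝ G n z) := by
    refine ⟨Submodule.smul_mem _ _ (pushChain_mem_markedCycles hGbd hz), ?_⟩
    have h := Submodule.smul_mem _ d⁻¹ hdiff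
    rwa [smul_sub, inv_smul_smul₀ hd] at h
  have hle : idealSimplicialVolume Y bdY n ζY ≤ l1Norm (d⁻¹ • pushChain ℝ G n z) := by
    refine csInf_le ⟨0, ?_⟩ ⟨_, hrep, rfl⟩
    rintro _ ⟨w, -, rfl⟩
    exact l1Norm_nonneg w
  rw [l1Norm_smul, abs_inv] at hle
  calc |d| * idealSimplicialVolume Y bdY n ζY
      ≤ |d| * (|d|⁻¹ * l1Norm (pushChain ℝ G n z)) := by gcongr
    _ = l1Norm (pushChain ℝ G n z) := mul_inv_cancel_left₀ (abs_ne_zero.2 hd) _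
    _ ≤ l1Norm z := l1Norm_pushChain_le G z
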